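/- For t ∈ (−1, 0), let α = (√2t, −t, −t, −t, 1) and α′ = (√2t, −t, t, t, 1) in ℝ⁵. Then q₋₁(α) = q₋₁(α′) = t² − 1 < 0 (both hyperplanes are spacelike), b₋₁(α, α′) = −(3t² + 1), and b₋₁(α,α′)² > q₋₁(α)·q₋₁(α′), so the two spacelike hyperplanes ker⟨α,·⟩ and ker⟨α′,·⟩ intersect transversely in AdS⁴, with angle φ_t = arccosh((3t²+1)/(1−t²)) satisfying cosh φ_t = |b₋₁(α,α′)|/√(q₋₁(α)q₋₁(α′)). Moreover the function t ↦ arccosh((3t²+1)/(1−t²)) on (−1,0) is strictly decreasing, tends to 0 as t → 0⁻, and tends to +∞ as t → −1⁺. -/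

import Mathlib

/-- The quadratic form `q₋₁(x) = -x₀² + x₁² + x₂² + x₃² - x₄²` on `ℝ⁵`. -/
noncomputable def qm1 (x : Fin 5 → ℝ) : ℝ :=
  -(x 0) ^ 2 + (x 1) ^ 2 + (x 2) ^ 2 + (x 3) ^ 2 - (x 4) ^ 2

/-- The associated bilinear form `b₋₁`. -/
noncomputable def bm1 (x y : Fin 5 → ℝ) : ℝ :=
  -(x 0 * y 0) + x 1 * y 1 + x 2 * y 2 + x 3 * y 3 - x 4 * y 4

/-- The inverse hyperbolic cosine, `arcosh x = log (x + √(x² - 1))`. -/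
noncomputable def arcosh (x : ℝ) : ℝ := Real.log (x + Real.sqrt (x ^ 2 - 1))

/-- The bounding covector `𝔭₀ = (√2t, -t, -t, -t, 1)` of the AdS Kerckhoff–Storm
polytope (`t ∈ (-1,0)`, so `|t| = -t`). -/
noncomputable def p0KS (t : ℝ) : Fin 5 → ℝ := ![Real.sqrt 2 * t, -t, -t, -t, 1]

/-- The bounding covector `𝔭₂ = (√2t, -t, t, t, 1)`. -/
noncomputable def p2KS (t : ℝ) : Fin 5 → ℝ := ![Real.sqrt 2 * t, -t, t, t, 1]

theorem arcosh_eq_real_arcosh : arcosh = Real.arcosh := rfl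

theorem tendsto_arcosh_atTop : Filter.Tendsto arcosh Filter.atTop Filter.atTop :=
  Real.tendsto_log_atTop.comp <|
    Filter.tendsto_id.atTop_add_nonneg fun _ => Real.sqrt_nonneg _

theorem qm1_p0KS (t : ℝ) : qm1 (p0KS t) = t ^ 2 - 1 := by
  have h : Real.sqrt 2 ^ 2 = 2 := Real.sq_sqrt zero_le_two
  simp only [qm1, p0KS, Matrix.cons_val, mul_pow, h]
  ring

theorem qm1_p2KS (t : ℝ) : qm1 (p2KS t) = t ^ 2 - 1 := by
  have h : Real.sqrt 2 ^ 2 = 2 := Real.sq_sqrt zero_le_two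
  simp only [qm1, p2KS, Matrix.cons_val, mul_pow, h]
  ring

theorem bm1_p0KS_p2KS (t : ℝ) : bm1 (p0KS t) (p2KS t) = -(3 * t ^ 2 + 1) := by
  have h : Real.sqrt 2 ^ 2 = 2 := Real.sq_sqrt zero_le_two
  simp only [bm1, p0KS, p2KS, Matrix.cons_val]
  linear_combination -t ^ 2 * h

theorem exists_qm1_neg_mem_ker_p0KS_p2KS (t : ℝ) :
    ∃ x : Fin 5 → ℝ, qm1 x < 0 ∧
      (∑ i, p0KS t i * x i) = 0 ∧ (∑ i, p2KS t i * x i) = 0 := by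
  refine ⟨![1, 0, 0, 0, -(Real.sqrt 2 * t)], ?_, ?_, ?_⟩
  · simp only [qm1, Matrix.cons_val]
    nlinarith [sq_nonneg (Real.sqrt 2 * t)]
  · simp [p0KS, Fin.sum_univ_five]
  · simp [p2KS, Fin.sum_univ_five]

theorem one_le_cosh_angle {t : ℝ} (ht : t ^ 2 < 1) :
    1 ≤ (3 * t ^ 2 + 1) / (1 - t ^ 2) := by
  rw [le_div_iff₀ (by linarith)]
  nlinarith [sq_nonneg t]

theorem cosh_angle_lt_cosh_angle {s t : ℝ} (hst : s ^ 2 < t ^ 2) (ht : t ^ 2 < 1) :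
    (3 * s ^ 2 + 1) / (1 - s ^ 2) < (3 * t ^ 2 + 1) / (1 - t ^ 2) := by
  rw [div_lt_div_iff₀ (by linarith) (by linarith)]
  nlinarith

theorem tendsto_cosh_angle_atTop :
    Filter.Tendsto (fun t : ℝ => (3 * t ^ 2 + 1) / (1 - t ^ 2))
      (nhdsWithin (-1) (Set.Ioi (-1))) Filter.atTop := by
  have hnum : Filter.Tendsto (fun t : ℝ => 3 * t ^ 2 + 1)
      (nhdsWithin (-1) (Set.Ioi (-1))) (nhds (3 * (-1) ^ 2 + 1)) :=
    Continuous.tendsto' (by fun_prop) _ _ rfl |>.mono_left nhdsWithin_le_nhds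
  have hden : Filter.Tendsto (fun t : ℝ => 1 - t ^ 2)
      (nhdsWithin (-1) (Set.Ioi (-1))) (nhdsWithin 0 (Set.Ioi 0)) := by
    refine tendsto_nhdsWithin_iff.2
      ⟨(Continuous.tendsto' (by fun_prop) _ _ (by norm_num)).mono_left nhdsWithin_le_nhds, ?_⟩
    filter_upwards [Ioo_mem_nhdsGT (show (-1 : ℝ) < 0 by norm_num)] with t ht
    have := ht.1
    have := ht.2
    exact Set.mem_Ioi.2 (by nlinarith)
  exact hnum.pos_mul_atTop (by norm_num) (tendsto_inv_nhdsGT_zero.comp hden)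

/-- The non-constant angle of the Anti-de Sitter Kerckhoff–Storm polytope:
`φ_t = arccosh((3t²+1)/(1-t²))`, which on `(-1,0)` is strictly decreasing, tends to `0` as
`t → 0⁻`, and tends to `+∞` as `t → -1⁺`. -/
theorem adS_angle :
    (∀ t ∈ Set.Ioo (-1 : ℝ) 0,
      qm1 (p0KS t) = t ^ 2 - 1 ∧
      qm1 (p2KS t) = t ^ 2 - 1 ∧
      qm1 (p0KS t) < 0 ∧ qm1 (p2KS t) < 0 ∧
      bm1 (p0KS t) (p2KS t) = -(3 * t ^ 2 + 1) ∧
      qm1 (p0KS t) * qm1 (p2KS t) < (bm1 (p0KS t) (p2KS t)) ^ 2 ∧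
      (∃ x : Fin 5 → ℝ, qm1 x < 0 ∧
        (∑ i, p0KS t i * x i) = 0 ∧ (∑ i, p2KS t i * x i) = 0) ∧
      Real.cosh (arcosh ((3 * t ^ 2 + 1) / (1 - t ^ 2)))
        = |bm1 (p0KS t) (p2KS t)| / Real.sqrt (qm1 (p0KS t) * qm1 (p2KS t))) ∧
    StrictAntiOn (fun t : ℝ => arcosh ((3 * t ^ 2 + 1) / (1 - t ^ 2)))
      (Set.Ioo (-1 : ℝ) 0) ∧
    Filter.Tendsto (fun t : ℝ => arcosh ((3 * t ^ 2 + 1) / (1 - t ^ 2)))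
      (nhdsWithin 0 (Set.Iio 0)) (nhds 0) ∧
    Filter.Tendsto (fun t : ℝ => arcosh ((3 * t ^ 2 + 1) / (1 - t ^ 2)))
      (nhdsWithin (-1) (Set.Ioi (-1))) Filter.atTop := by
  refine ⟨fun t ht => ?_, fun s hs t ht hst => ?_, ?_, ?_⟩
  · have ht1 : t ^ 2 < 1 := by nlinarith [ht.1, ht.2]
    have ht0 : 0 < t ^ 2 := sq_pos_of_neg ht.2
    rw [qm1_p0KS, qm1_p2KS, bm1_p0KS_p2KS]
    refine ⟨rfl, rfl, by linarith, by linarith, rfl, by nlinarith,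
      exists_qm1_neg_mem_ker_p0KS_p2KS t, ?_⟩
    rw [arcosh_eq_real_arcosh, Real.cosh_arcosh (one_le_cosh_angle ht1), abs_neg,
      abs_of_pos (by positivity), Real.sqrt_mul_self_eq_abs, abs_of_neg (by linarith), neg_sub]
  · have hs1 : s ^ 2 < 1 := by nlinarith [hs.1, hs.2]
    have hts : t ^ 2 < s ^ 2 := by nlinarith [ht.2]
    have hlt := cosh_angle_lt_cosh_angle hts hs1
    have h1 := one_le_cosh_angle (hts.trans hs1)
    exact Real.strictMonoOn_arcosh (Set.mem_Ioi.2 (by linarith)) (Set.mem_Ioi.2 (by linarith)) hlt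
  · refine Filter.Tendsto.mono_left ?_ nhdsWithin_le_nhds
    have h : ContinuousAt (fun t : ℝ => arcosh ((3 * t ^ 2 + 1) / (1 - t ^ 2))) 0 := by
      unfold arcosh
      refine ContinuousAt.log ?_ (by norm_num)
      have hdiv : ContinuousAt (fun t : ℝ => (3 * t ^ 2 + 1) / (1 - t ^ 2)) 0 :=
        ContinuousAt.div (by fun_prop) (by fun_prop) (by norm_num)
      exact hdiv.add ((hdiv.pow 2).sub continuousAt_const).sqrt
    simpa [ContinuousAt, arcosh] using h
  · exact tendsto_arcosh_atTop.comp tendsto_cosh_angle_atTop
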